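/- For all θ ∈ (0, 1], the following two-sided bound holds: 2θ − (4/3)θ³ + (4/15)θ⁵ − (1/27)θ⁷ + (31/4050)θ⁹ − (1/4050)θ¹¹ + (1/16200)θ¹³ < sin(2θ) < 2θ − (4/3)θ³ + (4/15)θ⁵ − (2/135)θ⁷ + (1/4050)θ⁹. -/

import Mathlib

open Real

lemma nonneg_of_deriv_aux (f g : ℝ → ℝ) (hf : ∀ x, HasDerivAt f (g x) x) (h0 : f 0 = 0)
    (hg : ∀ x, 0 ≤ x → 0 ≤ g x) : ∀ x, 0 ≤ x → 0 ≤ f x := by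
  intro x hx
  have hm : MonotoneOn f (Set.Ici 0) := by
    apply monotoneOn_of_deriv_nonneg (convex_Ici 0)
    · exact fun y _ => (hf y).continuousAt.continuousWithinAt
    · exact fun y _ => (hf y).differentiableAt.differentiableWithinAt
    · intro y hy
      rw [(hf y).deriv]
      rw [interior_Ici] at hy
      exact hg y (le_of_lt hy)
  have := hm (Set.mem_Ici.2 le_rfl) (Set.mem_Ici.2 hx) hx
  rwa [h0] at this

/-- Derivative of a monomial, in the shape used below. -/
lemma mono_aux (n : ℕ) (c : ℝ) (x : ℝ) :
    HasDerivAt (fun y : ℝ => c * y ^ n) (c * (n * x ^ (n - 1))) x :=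
  (hasDerivAt_pow n x).const_mul c

lemma sin_step (p q : ℝ → ℝ) (s : ℝ) (hp : ∀ x, HasDerivAt p (q x) x) (h0 : p 0 = 0)
    (h : ∀ x, 0 ≤ x → 0 ≤ s * (cos x - q x)) : ∀ x, 0 ≤ x → 0 ≤ s * (sin x - p x) :=
  nonneg_of_deriv_aux _ _ (fun x => ((hasDerivAt_sin x).sub (hp x)).const_mul s)
    (by simp [h0]) h

lemma cos_step (p q : ℝ → ℝ) (s : ℝ) (hp : ∀ x, HasDerivAt p (-q x) x) (h0 : p 0 = 1)
    (h : ∀ x, 0 ≤ x → 0 ≤ s * (sin x - q x)) : ∀ x, 0 ≤ x → 0 ≤ (-s) * (cos x - p x) :=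
  nonneg_of_deriv_aux _ _ (fun x => ((hasDerivAt_cos x).sub (hp x)).const_mul (-s))
    (by simp [h0]) (fun x hx => by have := h x hx; linarith)

lemma sin_taylor_bounds (x : ℝ) (hx : 0 ≤ x) :
    x - 1/6 * x^3 + 1/120 * x^5 - 1/5040 * x^7 ≤ sin x ∧
    sin x ≤ x - 1/6 * x^3 + 1/120 * x^5 - 1/5040 * x^7 + 1/362880 * x^9 := by
  have c0 : ∀ x : ℝ, 0 ≤ x → 0 ≤ (-1 : ℝ) * (cos x - 1) := fun x _ => by
    linarith [cos_le_one x]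
  have s1 := sin_step (fun x => x) (fun _ => 1) (-1) (fun x => hasDerivAt_id x) rfl c0
  have c2 := cos_step (fun x => 1 - 1/2 * x^2) _ _ (fun x => by
    refine HasDerivAt.congr_deriv ((mono_aux 2 (1/2) x).const_sub 1) ?_
    push_cast; ring) (by norm_num) s1
  have s3 := sin_step (fun x => x - 1/6 * x^3) _ _ (fun x => by
    refine HasDerivAt.congr_deriv ((hasDerivAt_id x).sub (mono_aux 3 (1/6) x)) ?_
    push_cast; ring) (by norm_num) c2
  have c4 := cos_step (fun x => 1 - 1/2 * x^2 + 1/24 * x^4) _ _ (fun x => by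
    refine HasDerivAt.congr_deriv (((mono_aux 2 (1/2) x).const_sub 1).add (mono_aux 4 (1/24) x)) ?_
    push_cast; ring) (by norm_num) s3
  have s5 := sin_step (fun x => x - 1/6 * x^3 + 1/120 * x^5) _ _ (fun x => by
    refine HasDerivAt.congr_deriv (((hasDerivAt_id x).sub (mono_aux 3 (1/6) x)).add (mono_aux 5 (1/120) x)) ?_
    push_cast; ring) (by norm_num) c4
  have c6 := cos_step (fun x => 1 - 1/2 * x^2 + 1/24 * x^4 - 1/720 * x^6) _ _ (fun x => by
    refine HasDerivAt.congr_deriv ((((mono_aux 2 (1/2) x).const_sub 1).add (mono_aux 4 (1/24) x)).sub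
      (mono_aux 6 (1/720) x)) ?_
    push_cast; ring) (by norm_num) s5
  have s7 := sin_step (fun x => x - 1/6 * x^3 + 1/120 * x^5 - 1/5040 * x^7) _ _ (fun x => by
    refine HasDerivAt.congr_deriv ((((hasDerivAt_id x).sub (mono_aux 3 (1/6) x)).add (mono_aux 5 (1/120) x)).sub
      (mono_aux 7 (1/5040) x)) ?_
    push_cast; ring) (by norm_num) c6
  have c8 := cos_step (fun x => 1 - 1/2 * x^2 + 1/24 * x^4 - 1/720 * x^6 + 1/40320 * x^8) _ _
    (fun x => by
      refine HasDerivAt.congr_deriv (((((mono_aux 2 (1/2) x).const_sub 1).add (mono_aux 4 (1/24) x)).sub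
        (mono_aux 6 (1/720) x)).add (mono_aux 8 (1/40320) x)) ?_
      push_cast; ring) (by norm_num) s7
  have s9 := sin_step (fun x => x - 1/6 * x^3 + 1/120 * x^5 - 1/5040 * x^7 + 1/362880 * x^9) _ _
    (fun x => by
      refine HasDerivAt.congr_deriv (((((hasDerivAt_id x).sub (mono_aux 3 (1/6) x)).add (mono_aux 5 (1/120) x)).sub
        (mono_aux 7 (1/5040) x)).add (mono_aux 9 (1/362880) x)) ?_
      push_cast; ring) (by norm_num) c8
  have a := s7 x hx
  have b := s9 x hx
  constructor <;> linarith

theorem sin_two_theta_bounds (θ : ℝ) (h0 : 0 < θ) (h1 : θ ≤ 1) :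
    2 * θ - (4 / 3) * θ ^ 3 + (4 / 15) * θ ^ 5 - (1 / 27) * θ ^ 7
        + (31 / 4050) * θ ^ 9 - (1 / 4050) * θ ^ 11 + (1 / 16200) * θ ^ 13
      < Real.sin (2 * θ) ∧
    Real.sin (2 * θ)
      < 2 * θ - (4 / 3) * θ ^ 3 + (4 / 15) * θ ^ 5 - (2 / 135) * θ ^ 7
        + (1 / 4050) * θ ^ 9 := by
  obtain ⟨a, b⟩ := sin_taylor_bounds (2 * θ) (by linarith)
  have p7 : 0 < θ ^ 7 := by positivity
  have h9 : θ ^ 9 ≤ θ ^ 7 := pow_le_pow_of_le_one h0.le h1 (by norm_num)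
  have h13 : θ ^ 13 ≤ θ ^ 11 := pow_le_pow_of_le_one h0.le h1 (by norm_num)
  have p11 : 0 < θ ^ 11 := by positivity
  have e : sin (2 * θ) = sin (θ * 2) := by rw [mul_comm]
  rw [e]
  ring_nf at a b
  constructor <;> linarith
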